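/- arXiv:2501.01708 — 4 statements merged into one kernel-verified Lean document; each statement's English description precedes it below -/
import Mathlib

section
/- Let $\mathbb{F}_q$ be a finite field, $l \geq 1$, and $\mathcal{R} := \mathbb{F}_q^l$ the product ring. Let $\theta_1, \dots, \theta_l$ be automorphisms of $\mathbb{F}_q$, $\Theta := \theta_1 \times \cdots \times \theta_l$ the componentwise automorphism of $\mathcal{R}$, $s = (s_1, \dots, s_l) \in \mathcal{R}$, $\Delta(r) := s(\Theta(r) - r)$, and $a = (a_1, \dots, a_l)$ a unit of $\mathcal{R}$. Let $n \geq 1$, and define $T : \mathcal{R}^n \to \mathcal{R}^n$ by $T(c_0, \dots, c_{n-1}) = (a\,\Theta(c_{n-1}) + \Delta(c_0),\ \Theta(c_0) + \Delta(c_1),\ \dots,\ \Theta(c_{n-2}) + \Delta(c_{n-1}))$, and for each $1 \le i \le l$ define $T_i : \mathbb{F}_q^n \to \mathbb{F}_q^n$ by $T_i(v_0, \dots, v_{n-1}) = (a_i\,\theta_i(v_{n-1}) + \delta_i(v_0),\ \theta_i(v_0) + \delta_i(v_1),\ \dots,\ \theta_i(v_{n-2}) + \delta_i(v_{n-1}))$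 where $\delta_i(x) := s_i(\theta_i(x) - x)$. Let $\mathcal{C}$ be an $\mathcal{R}$-submodule of $\mathcal{R}^n$ and for each $i$ let $\mathcal{C}_i := \tilde{\pi}_i(\mathcal{C}) \subseteq \mathbb{F}_q^n$ be the image of $\mathcal{C}$ under the coordinatewise $i$-th projection. Then $T(\mathcal{C}) \subseteq \mathcal{C}$ if and only if $T_i(\mathcal{C}_i) \subseteq \mathcal{C}_i$ for every $1 \le i \le l$. -/
/-- A vector over `F^l` lies in a submodule as soon as each of its projections lifts to it. -/
theorem mem_of_forall_exists_proj_eq {F ι κ : Type*} [Semiring F] [Fintype ι]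
    (C : Submodule (ι → F) (κ → ι → F)) (x : κ → ι → F)
    (h : ∀ i, ∃ d ∈ C, ∀ k, d k i = x k i) : x ∈ C := by
  classical
  choose d hd hdx using h
  have hx : x = ∑ i, (Pi.single i 1 : ι → F) • d i := by
    ext k j
    simp [Finset.sum_apply, Pi.single_apply, hdx]
  rw [hx]
  exact C.sum_mem fun i _ => C.smul_mem _ (hd i)


/-- Decomposition theorem: an `R`-submodule `C ⊆ R^n` (`R = F^l`) is invariant under the
pseudo-linear transformation `T = T_{Θ, Δ, M_a}` (with `Θ = θ₁ × ⋯ × θ_l` componentwise,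
`Δ(r) = s(Θ(r) - r)`, and `a` a unit) if and only if each projection
`Cᵢ = π̃ᵢ(C) ⊆ F^n` is invariant under the corresponding transformation
`Tᵢ = T_{θᵢ, δᵢ, M_{aᵢ}}`, where `δᵢ(x) = sᵢ(θᵢ(x) - x)`.
(In `Fin n`, `0 - 1 = n - 1`, so the `j = 0` entry involves `c_{n-1}`.) -/
theorem stmt5 {F : Type*} [Field F] [Fintype F] (l n : ℕ) (hl : 1 ≤ l) [NeZero n]
    (θ : Fin l → (F ≃+* F)) (Θ : (Fin l → F) ≃+* (Fin l → F))
    (hΘ : ∀ (r : Fin l → F) (i : Fin l), Θ r i = θ i (r i))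
    (s a : Fin l → F) (ha : IsUnit a)
    (T : (Fin n → Fin l → F) → (Fin n → Fin l → F))
    (hT : ∀ c j, T c j =
      if j = 0 then a * Θ (c (j - 1)) + s * (Θ (c j) - c j)
      else Θ (c (j - 1)) + s * (Θ (c j) - c j))
    (Ti : Fin l → (Fin n → F) → (Fin n → F))
    (hTi : ∀ i v j, Ti i v j =
      if j = 0 then a i * θ i (v (j - 1)) + s i * (θ i (v j) - v j)
      else θ i (v (j - 1)) + s i * (θ i (v j) - v j))
    (C : Submodule (Fin l → F) (Fin n → Fin l → F)) :
    (∀ c ∈ C, T c ∈ C) ↔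
      ∀ i : Fin l, ∀ v ∈ (fun (d : Fin n → Fin l → F) (k : Fin n) => d k i) '' (C : Set _),
        Ti i v ∈ (fun (d : Fin n → Fin l → F) (k : Fin n) => d k i) '' (C : Set _) := by
  have hproj : ∀ c i, Ti i (fun k => c k i) = fun k => T c k i := by
    intro c i
    funext j
    rw [hTi, hT]
    split_ifs <;> simp [hΘ]
  constructor
  · rintro h i _ ⟨c, hc, rfl⟩
    exact ⟨T c, h c hc, (hproj c i).symm⟩
  · intro h c hc
    refine mem_of_forall_exists_proj_eq C _ fun i => ?_
    obtain ⟨d, hd, hdi⟩ := h i _ ⟨c, hc, rfl⟩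
    exact ⟨d, hd, congrFun (hdi.trans (hproj c i))⟩
end

section
/- Let $\mathbb{F}_q$ be a finite field, $n \geq 1$, and let $\theta$ be a field automorphism of $\mathbb{F}_q$ with $\theta^n = \mathrm{id}$. Let $\alpha \in \mathbb{F}_q^{\times}$ with $\theta(\alpha) = \alpha$. Define $T : \mathbb{F}_q^n \to \mathbb{F}_q^n$ by $T(c_0, c_1, \dots, c_{n-1}) = (\alpha\,\theta(c_{n-1}),\ \theta(c_0),\ \dots,\ \theta(c_{n-2}))$ and $T' : \mathbb{F}_q^n \to \mathbb{F}_q^n$ by $T'(d_0, d_1, \dots, d_{n-1}) = (\alpha^{-1}\,\theta(d_{n-1}),\ \theta(d_0),\ \dots,\ \theta(d_{n-2}))$. If $\mathcal{C}$ is an $\mathbb{F}_q$-subspace of $\mathbb{F}_q^n$ with $T(\mathcal{C}) \subseteq \mathcal{C}$, then its Euclidean dual $\mathcal{C}^{\perp}$ satisfies $T'(\mathcal{C}^{\perp}) \subseteq \mathcal{C}^{\perp}$. In other words, the Euclidean dual of a $(\theta, 0, \alpha)$-cyclic code of length $n$ over $\mathbb{F}_q$ is a $(\theta, 0, \alpha^{-1})$-cyclic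 code of length $n$ over $\mathbb{F}_q$. -/
/-- If `θ` is an automorphism of `F` with `θⁿ = id`, `α ∈ F^×` with `θ(α) = α`, and
`C ⊆ F^n` is a `(θ, 0, α)`-cyclic code, i.e. invariant under the pseudo-linear map
`T(c₀, …, c_{n-1}) = (α θ(c_{n-1}), θ(c₀), …, θ(c_{n-2}))`, then its Euclidean dual
`C^⊥` is invariant under
`T'(d₀, …, d_{n-1}) = (α⁻¹ θ(d_{n-1}), θ(d₀), …, θ(d_{n-2}))`,
i.e. `C^⊥` is a `(θ, 0, α⁻¹)`-cyclic code.
(In `Fin n`, `0 - 1 = n - 1`, so `c (j - 1)` is `c_{n-1}` when `j = 0`.) -/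
theorem stmt12 {F : Type*} [Field F] [Fintype F] (n : ℕ) [NeZero n]
    (θ : F ≃+* F) (hθn : ∀ x : F, (⇑θ)^[n] x = x)
    (α : F) (hα : α ≠ 0) (hfix : θ α = α)
    (T : (Fin n → F) → (Fin n → F))
    (hT : ∀ c j, T c j = if j = 0 then α * θ (c (j - 1)) else θ (c (j - 1)))
    (T' : (Fin n → F) → (Fin n → F))
    (hT' : ∀ d j, T' d j = if j = 0 then α⁻¹ * θ (d (j - 1)) else θ (d (j - 1)))
    (C : Submodule F (Fin n → F))
    (hC : ∀ c ∈ C, T c ∈ C) :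
    ∀ d ∈ {x : Fin n → F | ∀ c ∈ C, ∑ i, x i * c i = 0},
      T' d ∈ {x : Fin n → F | ∀ c ∈ C, ∑ i, x i * c i = 0} := by
  intro d hd c hc
  have hTinj : Function.Injective T := by
    intro x y hxy
    funext k
    have h := congrFun hxy (k + 1)
    rw [hT, hT, add_sub_cancel_right] at h
    split_ifs at h
    · exact θ.injective (mul_left_cancel₀ hα h)
    · exact θ.injective h
  obtain ⟨⟨b, hb⟩, hbc⟩ :=
    Finite.surjective_of_injective
      (f := fun x : C => (⟨T x, hC x x.2⟩ : C))
      (fun x y h => Subtype.ext (hTinj (congrArg Subtype.val h))) ⟨c, hc⟩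
  obtain rfl : T b = c := congrArg Subtype.val hbc
  have hterm : ∀ j, T' d j * T b j = θ (d (j - 1) * b (j - 1)) := by
    intro j
    rw [hT, hT', map_mul]
    split_ifs
    · field_simp
    · rfl
  calc ∑ j, T' d j * T b j = ∑ j, θ (d (j - 1) * b (j - 1)) :=
        Finset.sum_congr rfl fun j _ => hterm j
    _ = ∑ j, θ (d j * b j) :=
        (Equiv.subRight (1 : Fin n)).sum_comp fun j => θ (d j * b j)
    _ = 0 := by rw [← map_sum, hd b hb, map_zero]
end

section
/- Let $\mathbb{F}_q$ be a finite field, $l \geq 1$, $\mathcal{R} := \mathbb{F}_q^l$ the product ring, and $n \geq 1$. Let $\mathcal{C}$ be an $\mathcal{R}$-submodule of $\mathcal{R}^n$ and for $1 \le i \le l$ let $\mathcal{C}_i := \tilde{\pi}_i(\mathcal{C}) \subseteq \mathbb{F}_q^n$. Then for every $1 \le i \le l$, $\tilde{\pi}_i(\mathcal{C}^{\perp}) = \mathcal{C}_i^{\perp}$; that is, the Euclidean dual of $\mathcal{C}$ decomposes componentwise as $\mathcal{C}^{\perp} = e_1\mathcal{C}_1^{\perp} \oplus e_2\mathcal{C}_2^{\perp}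 \oplus \cdots \oplus e_l\mathcal{C}_l^{\perp}$. -/
/-- For an `R`-submodule `C ⊆ R^n` (`R = F^l`) with projections `Cᵢ = π̃ᵢ(C) ⊆ F^n`,
the Euclidean dual decomposes componentwise: `π̃ᵢ(C^⊥) = Cᵢ^⊥` for every `i`, which
expresses `C^⊥ = e₁C₁^⊥ ⊕ ⋯ ⊕ e_lC_l^⊥`. -/
theorem stmt15 {F : Type*} [Field F] [Fintype F] (l n : ℕ) (hl : 1 ≤ l) (hn : 1 ≤ n)
    (C : Submodule (Fin l → F) (Fin n → Fin l → F)) :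
    ∀ i : Fin l,
      (fun (d : Fin n → Fin l → F) (k : Fin n) => d k i) ''
          {x : Fin n → Fin l → F | ∀ c ∈ C, ∑ j, x j * c j = 0} =
        {v : Fin n → F |
          ∀ w ∈ (fun (d : Fin n → Fin l → F) (k : Fin n) => d k i) '' (C : Set _),
            ∑ j, v j * w j = 0} := by
  intro i
  ext v
  constructor
  · rintro ⟨x, hx, rfl⟩ w ⟨c, hc, rfl⟩
    simpa [Finset.sum_apply] using congrFun (hx c hc) i
  · intro hv
    refine ⟨fun j => Pi.single i (v j), fun c hc => ?_, by simp⟩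
    ext k
    by_cases hk : k = i
    · subst hk
      simpa [Finset.sum_apply] using hv _ ⟨c, hc, rfl⟩
    · simp [Finset.sum_apply, hk]
end

section
/- Let $\mathbb{F}_q$ be a finite field, $n \geq 1$, and $\alpha \in \mathbb{F}_q^{\times}$. Let $g, h \in \mathbb{F}_q[x]$ satisfy $x^n - \alpha = h(x) g(x)$. Let $\mathcal{C} := \{ \text{remainder of } f(x) g(x) \text{ upon division by } x^n - \alpha : f \in \mathbb{F}_q[x] \}$ be the constacyclic code generated by $g$ (equivalently, the ideal generated by the image of $g$ in $\mathbb{F}_q[x]/\langle x^n - \alpha \rangle$), and let $\mathcal{C}^{\circ} := \{ f \in \mathbb{F}_q[x] : \deg f < n \text{ and } \langle f \mid c \rangle = 0 \text{ for all } c \in \mathcal{C} \}$ be its annihilator dual, where $\langle f \mid c \rangle$ is the constant coefficient of the remainder of $f c$ upon division by $x^n - \alpha$. Then $\mathcal{C}^{\circ} \subseteq \mathcal{C}$ if and only if $g$ divides $h$ in $\mathbb{F}_q[x]$. -/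
open Polynomial

/-- The form sending `p`, `r` to the constant coefficient of `p r mod (Xⁿ - α)` is nondegenerate. -/
theorem dvd_of_coeff_zero_mul_modByMonic_eq_zero {F : Type*} [Field F] {n : ℕ} (hn : n ≠ 0)
    {α : F} (hα : α ≠ 0) {r : F[X]}
    (hr : ∀ p : F[X], ((p * r) %ₘ (X ^ n - C α)).coeff 0 = 0) :
    X ^ n - C α ∣ r := by
  have hm : (X ^ n - C α).Monic := monic_X_pow_sub_C α hn
  have hdeg : (X ^ n - C α).degree = (n : WithBot ℕ) := degree_X_pow_sub_C (Nat.pos_of_ne_zero hn) α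
  rw [← modByMonic_eq_zero_iff_dvd hm]
  set s := r %ₘ (X ^ n - C α) with hs
  by_contra hs0
  have hslt : s.natDegree < n := by
    rw [natDegree_lt_iff_degree_lt hs0, ← hdeg]
    exact degree_modByMonic_lt r hm
  have hl : s.leadingCoeff ≠ 0 := leadingCoeff_ne_zero.mpr hs0
  set t := X ^ (n - s.natDegree) * s - C s.leadingCoeff * (X ^ n - C α) with ht
  have htlt : t.degree < (X ^ n - C α).degree := by
    have hXs : (X ^ (n - s.natDegree) * s).degree = (X ^ n - C α).degree := by
      rw [degree_mul, degree_X_pow, degree_eq_natDegree hs0, hdeg, ← Nat.cast_add,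
        Nat.sub_add_cancel hslt.le]
    rw [← hXs]
    refine degree_sub_lt_left ?_ (mul_ne_zero (pow_ne_zero _ X_ne_zero) hs0) ?_
    · rw [hXs, degree_C_mul hl]
    · simp [hm.leadingCoeff]
  have hmod : (X ^ (n - s.natDegree) * r) %ₘ (X ^ n - C α) = t := by
    refine (div_modByMonic_unique
      (X ^ (n - s.natDegree) * (r /ₘ (X ^ n - C α)) + C s.leadingCoeff) t hm ⟨?_, htlt⟩).2
    have hdiv : s + (X ^ n - C α) * (r /ₘ (X ^ n - C α)) = r := modByMonic_add_div r _
    linear_combination X ^ (n - s.natDegree) * hdiv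
  have hcoeff := hr (X ^ (n - s.natDegree))
  rw [hmod, ht] at hcoeff
  have hpos : n - s.natDegree ≠ 0 := by lia
  simp [mul_coeff_zero, coeff_X_pow, hn.symm, hpos.symm, hα, hs0] at hcoeff

/-- Let `Xⁿ - α = h g` in `F[x]` (`α ≠ 0`, `n ≥ 1`), let
`𝒞 = { f g mod (Xⁿ - α) : f ∈ F[x] }` be the `α`-constacyclic code generated by `g`,
and let `𝒞° = { f : deg f < n, ⟨f ∣ c⟩ = 0 for all c ∈ 𝒞 }` be its annihilator dual,
where `⟨f ∣ c⟩` is the constant coefficient of `f c mod (Xⁿ - α)`.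
Then `𝒞° ⊆ 𝒞` if and only if `g ∣ h`. -/
theorem stmt17 {F : Type*} [Field F] [Fintype F] (n : ℕ) (hn : 1 ≤ n)
    (α : F) (hα : α ≠ 0) (g h : F[X])
    (hfac : X ^ n - C α = h * g) :
    ({f : F[X] | f.degree < n ∧
        ∀ c ∈ {c : F[X] | ∃ f' : F[X], (f' * g) %ₘ (X ^ n - C α) = c},
          ((f * c) %ₘ (X ^ n - C α)).coeff 0 = 0} ⊆
      {c : F[X] | ∃ f' : F[X], (f' * g) %ₘ (X ^ n - C α) = c}) ↔
    g ∣ h := by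
  have hn0 : n ≠ 0 := Nat.one_le_iff_ne_zero.mp hn
  have hm : (X ^ n - C α).Monic := monic_X_pow_sub_C α hn0
  have hdeg : (X ^ n - C α).degree = (n : WithBot ℕ) := degree_X_pow_sub_C hn α
  have hg0 : g ≠ 0 := right_ne_zero_of_mul (hfac ▸ hm.ne_zero)
  have hgm : g ∣ X ^ n - C α := ⟨h, by rw [hfac, mul_comm]⟩
  have hmod (p : F[X]) : X ^ n - C α ∣ p - p %ₘ (X ^ n - C α) :=
    ⟨p /ₘ (X ^ n - C α), by linear_combination -modByMonic_add_div p (X ^ n - C α)⟩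
  constructor
  · intro hsub
    have hmem : h %ₘ (X ^ n - C α) ∈ {f : F[X] | f.degree < n ∧
        ∀ c ∈ {c : F[X] | ∃ f' : F[X], (f' * g) %ₘ (X ^ n - C α) = c},
          ((f * c) %ₘ (X ^ n - C α)).coeff 0 = 0} := by
      refine ⟨hdeg ▸ degree_modByMonic_lt h hm, ?_⟩
      rintro _ ⟨p, rfl⟩
      rw [← mul_modByMonic, (modByMonic_eq_zero_iff_dvd hm).mpr ⟨p, by rw [hfac]; ring⟩,
        coeff_zero]
    obtain ⟨p, hp⟩ := hsub hmem
    have hdvd : g ∣ h %ₘ (X ^ n - C α) :=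
      hp ▸ (dvd_iff_dvd_of_dvd_sub (hgm.trans (hmod _))).mp (dvd_mul_left g p)
    exact (dvd_iff_dvd_of_dvd_sub (hgm.trans (hmod h))).mpr hdvd
  · rintro hgh f ⟨hflt, hf⟩
    have hself : f %ₘ (X ^ n - C α) = f := (modByMonic_eq_self_iff hm).mpr (hdeg ▸ hflt)
    have hdvd : X ^ n - C α ∣ f * g := by
      refine dvd_of_coeff_zero_mul_modByMonic_eq_zero hn0 hα fun p => ?_
      have hfp := hf _ ⟨p, rfl⟩
      rwa [← hself, ← mul_modByMonic, mul_left_comm] at hfp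
    rw [hfac] at hdvd
    obtain ⟨p, rfl⟩ := hgh.trans ((mul_dvd_mul_iff_right hg0).mp hdvd)
    exact ⟨p, by rwa [mul_comm p g]⟩
end
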